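/- Let G = x₀x₂³ − x₁³x₃ − x₁x₃³ ∈ ℂ[x₀,x₁,x₂,x₃]. Then the set of common zeros in ℂ⁴ of the four partial derivatives ∂G/∂x₀, ∂G/∂x₁, ∂G/∂x₂, ∂G/∂x₃ is exactly {(t,0,0,0) : t ∈ ℂ}. Equivalently, the quartic surface S = {G = 0} ⊂ ℙ³ over ℂ is irreducible with zero-dimensional singular locus, namely the single point [1:0:0:0]. -/

import Mathlib

open MvPolynomial

/-- The quartic `G = x₀x₂³ − x₁³x₃ − x₁x₃³`. -/
noncomputable def Gpoly : MvPolynomial (Fin 4) ℂ :=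
  X 0 * X 2 ^ 3 - X 1 ^ 3 * X 3 - X 1 * X 3 ^ 3

/-- The common zero locus in `ℂ⁴` of the four partial derivatives of `G` is exactly
`{(t,0,0,0) : t ∈ ℂ}`; equivalently, the quartic surface `S = {G = 0} ⊂ ℙ³` has
zero-dimensional singular locus, namely the single point `[1:0:0:0]`. -/
theorem statement15 :
    {v : Fin 4 → ℂ | ∀ i : Fin 4, eval v (pderiv i Gpoly) = 0} =
      {v : Fin 4 → ℂ | v 1 = 0 ∧ v 2 = 0 ∧ v 3 = 0} := by
  ext v
  have e0 : eval v (pderiv 0 Gpoly) = v 2 ^ 3 := by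
    simp [Gpoly, pderiv_X, Derivation.leibniz, Derivation.leibniz_pow]
  have e1 : eval v (pderiv 1 Gpoly) = -(v 3 * (3 * v 1 ^ 2 + v 3 ^ 2)) := by
    simp [Gpoly, pderiv_X, Derivation.leibniz, Derivation.leibniz_pow]
    ring
  have e2 : eval v (pderiv 2 Gpoly) = 3 * v 0 * v 2 ^ 2 := by
    simp [Gpoly, pderiv_X, Derivation.leibniz, Derivation.leibniz_pow]
    ring
  have e3 : eval v (pderiv 3 Gpoly) = -(v 1 * (v 1 ^ 2 + 3 * v 3 ^ 2)) := by
    simp [Gpoly, pderiv_X, Derivation.leibniz, Derivation.leibniz_pow]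
    ring
  simp only [Set.mem_ofPred_eq, Fin.forall_fin_succ, IsEmpty.forall_iff, and_true]
  change (eval v (pderiv 0 Gpoly) = 0 ∧ eval v (pderiv 1 Gpoly) = 0 ∧
    eval v (pderiv 2 Gpoly) = 0 ∧ eval v (pderiv 3 Gpoly) = 0) ↔ _
  rw [e0, e1, e2, e3]
  constructor
  · rintro ⟨h0, h1, -, h3⟩
    have hc : v 3 ^ 5 = 0 := by
      linear_combination (-(v 3 ^ 2) - (3 / 8 : ℂ) * v 1 ^ 2) * h1 +
        (9 / 8 : ℂ) * v 1 * v 3 * h3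
    have hc' : v 3 = 0 := by simpa using hc
    have ha : v 1 ^ 3 = 0 := by
      rw [hc'] at h3
      linear_combination -h3
    exact ⟨by simpa using ha, by simpa using h0, hc'⟩
  · rintro ⟨h1, h2, h3⟩
    simp [h1, h2, h3]
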